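/- arXiv:2009.10880 — 5 statements merged into one kernel-verified Lean document; each statement's English description precedes it below -/
import Mathlib

section
/- Let R† be the relation on ℕ with R† 0 m iff m ≥ 1, and R† (i+1) i for every i ∈ ℕ (and no other pairs related), and let F† : Set ℕ → Set ℕ be F†(A) = {1} ∪ {w ∈ ℕ | ∀v, R† w v → v ∈ A}. Then the least fixed point of F† is all of ℕ; in particular 0 belongs to the least fixed point of F†. -/
/-- The accessibility relation of the model `M†`: `0` sees every `m ≥ 1`,
and `i+1` sees `i`. -/
def Rdag : ℕ → ℕ → Prop := fun a b => (a = 0 ∧ 1 ≤ b) ∨ (∃ i : ℕ, a = i + 1 ∧ b = i)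

/-- The semantic operator of `μX(p ∨ □X)` on `M†`, where `p` holds exactly at `1`. -/
def Fdag : Set ℕ → Set ℕ := fun A => {1} ∪ {w : ℕ | ∀ v : ℕ, Rdag w v → v ∈ A}

theorem Fdag_monotone : Monotone Fdag := by
  intro A B hAB w hw
  rcases hw with h | h
  · exact Or.inl h
  · exact Or.inr fun v hv => hAB (h v hv)

/-- The least fixed point of `Fdag` is all of `ℕ`; in particular `0` belongs to it. -/
theorem lfp_Fdag_eq_univ :
    OrderHom.lfp ⟨Fdag, Fdag_monotone⟩ = Set.univ ∧
      (0 : ℕ) ∈ OrderHom.lfp ⟨Fdag, Fdag_monotone⟩ := by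
  have key : ∀ w : ℕ, w ∈ OrderHom.lfp ⟨Fdag, Fdag_monotone⟩ := by
    have step : ∀ w, w ∈ Fdag (OrderHom.lfp ⟨Fdag, Fdag_monotone⟩) →
        w ∈ OrderHom.lfp ⟨Fdag, Fdag_monotone⟩ := by
      intro w hw
      have h := OrderHom.map_lfp (⟨Fdag, Fdag_monotone⟩ : Set ℕ →o Set ℕ)
      rw [← h]
      exact hw
    have hs : ∀ n : ℕ, n + 1 ∈ OrderHom.lfp ⟨Fdag, Fdag_monotone⟩ := by
      intro n
      induction n with
      | zero => exact step _ (Or.inl rfl)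
      | succ k ih =>
        refine step _ (Or.inr ?_)
        rintro v (⟨h, -⟩ | ⟨i, hi, rfl⟩)
        · omega
        · obtain rfl : v = k + 1 := by omega
          exact ih
    intro w
    cases w with
    | succ n => exact hs n
    | zero =>
      refine step _ (Or.inr ?_)
      rintro v (⟨-, h⟩ | ⟨i, hi, -⟩)
      · obtain ⟨n, rfl⟩ : ∃ n, v = n + 1 := ⟨v - 1, by omega⟩
        exact hs n
      · omega
  exact ⟨Set.eq_univ_of_forall key, key 0⟩
end

section
/- Let R† be the relation on ℕ with R† 0 m iff m ≥ 1, and R† (i+1) i for every i ∈ ℕ (and no other pairs related), and let F† : Set ℕ → Set ℕ be F†(A) = {1} ∪ {w ∈ ℕ | ∀v, R† w v → v ∈ A}. Then ⋃_{n∈ℕ} F†^[n](∅) = {m ∈ ℕ | m ≥ 1}; in particular 0 ∉ ⋃_{n∈ℕ} F†^[n](∅). -/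
theorem Fdag_iterate_aux (n : ℕ) : Fdag^[n] ∅ = {m : ℕ | 1 ≤ m ∧ m ≤ n} := by
  induction n with
  | zero => ext m; simp; omega
  | succ n ih =>
    rw [Function.iterate_succ_apply', ih]
    ext m
    simp only [Fdag, Rdag, Set.mem_union, Set.mem_singleton_iff, Set.mem_ofPred_eq]
    constructor
    · rintro (h | h)
      · omega
      · rcases m with _ | i
        · have := h (n + 1) (Or.inl ⟨rfl, by omega⟩)
          omega
        · have := h i (Or.inr ⟨i, rfl, rfl⟩)
          omega
    · rintro ⟨h1, h2⟩
      by_cases hm : m = 1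
      · exact Or.inl hm
      · right
        rintro v (⟨h, _⟩ | ⟨i, h, hi⟩) <;> omega

/-- The ω-approximant of `Fdag` (the union of its finite iterates on `∅`) is exactly
the set of states `≥ 1`; in particular `0` is not in it. -/
theorem iUnion_iterate_Fdag_eq :
    (⋃ n : ℕ, Fdag^[n] ∅) = {m : ℕ | 1 ≤ m} ∧ (0 : ℕ) ∉ ⋃ n : ℕ, Fdag^[n] ∅ := by
  have key : (⋃ n : ℕ, Fdag^[n] ∅) = {m : ℕ | 1 ≤ m} := by
    ext m
    simp only [Fdag_iterate_aux, Set.mem_iUnion, Set.mem_ofPred_eq]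
    exact ⟨fun ⟨_, h, _⟩ => h, fun h => ⟨m, h, le_rfl⟩⟩
  refine ⟨key, ?_⟩
  rw [key]
  simp
end

section
/- Let R† be the relation on ℕ with R† 0 m iff m ≥ 1, and R† (i+1) i for every i ∈ ℕ (and no other pairs related), and let F† : Set ℕ → Set ℕ be F†(A) = {1} ∪ {w ∈ ℕ | ∀v, R† w v → v ∈ A}. Then 0 ∈ F†(⋃_{n∈ℕ} F†^[n](∅)); that is, 0 belongs to the μ-approximant of F† at ordinal ω+1. -/
theorem succ_mem_iter (m : ℕ) : m + 1 ∈ Fdag^[m + 1] ∅ := by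
  induction m with
  | zero => exact Or.inl rfl
  | succ k ih =>
    rw [Function.iterate_succ_apply']
    refine Or.inr ?_
    rintro v (⟨h, _⟩ | ⟨i, hi, rfl⟩)
    · omega
    · obtain rfl : v = k + 1 := by omega
      exact ih

/-- `0` belongs to the `(ω+1)`-st μ-approximant of `Fdag`, i.e. to `Fdag` applied to
the union of the finite iterates of `Fdag` on `∅`. -/
theorem zero_mem_Fdag_omega_succ :
    (0 : ℕ) ∈ Fdag (⋃ n : ℕ, Fdag^[n] ∅) := by
  refine Or.inr ?_
  rintro v (⟨_, h⟩ | ⟨i, hi, _⟩)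
  · obtain ⟨m, rfl⟩ : ∃ m, v = m + 1 := ⟨v - 1, by omega⟩
    exact Set.mem_iUnion.2 ⟨m + 1, succ_mem_iter m⟩
  · omega
end

section
/- Let R† be the relation on ℕ with R† 0 m iff m ≥ 1, and R† (i+1) i for every i ∈ ℕ (and no other pairs related), and let F† : Set ℕ → Set ℕ be F†(A) = {1} ∪ {w ∈ ℕ | ∀v, R† w v → v ∈ A}. Then every v with R† 0 v satisfies v ∈ ⋃_{n∈ℕ} F†^[n](∅), while 0 ∉ ⋃_{n∈ℕ} F†^[n](∅). -/
/-- The `n`-th approximant is `{1, …, n}`. -/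
theorem Fdag_iter (n : ℕ) : Fdag^[n] ∅ = {w : ℕ | 1 ≤ w ∧ w ≤ n} := by
  induction n with
  | zero =>
    ext w
    simp only [Function.iterate_zero, id, Set.mem_empty_iff_false, Set.mem_setOf_eq, false_iff]
    omega
  | succ n ih =>
    rw [Function.iterate_succ_apply', ih]
    ext w
    simp only [Fdag, Rdag, Set.mem_union, Set.mem_singleton_iff, Set.mem_setOf_eq]
    constructor
    · rintro (rfl | h)
      · omega
      · rcases w with _ | i
        · have := h (n + 1) (Or.inl ⟨rfl, by omega⟩)
          omega
        · have := h i (Or.inr ⟨i, rfl, rfl⟩)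
          omega
    · rintro ⟨h1, h2⟩
      by_cases hw : w = 1
      · exact Or.inl hw
      · right
        rintro v (⟨h0, _⟩ | ⟨i, hi, rfl⟩) <;> omega

/-- Every `Rdag`-successor of `0` lies in the ω-approximant `⋃_n Fdag^[n](∅)`,
but `0` itself does not: the model `M†` satisfies `□φ_AFp ∧ ¬φ_AFp` at `0` under
the finitely bounded semantics. -/
theorem box_holds_but_not_here :
    (∀ v : ℕ, Rdag 0 v → v ∈ ⋃ n : ℕ, Fdag^[n] ∅) ∧
      (0 : ℕ) ∉ ⋃ n : ℕ, Fdag^[n] ∅ := by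
  simp only [Fdag_iter, Set.mem_iUnion, Set.mem_setOf_eq]
  constructor
  · rintro v (⟨_, h⟩ | ⟨i, hi, _⟩)
    · exact ⟨v, h, le_rfl⟩
    · omega
  · rintro ⟨n, h, _⟩
    omega
end

section
/- Let R* be the relation on ℕ with R* 0 m iff m ≥ 1, and R* (i+1) i for every i ∈ ℕ (and no other pairs related). For B ⊆ ℕ define H_B : Set ℕ → Set ℕ by H_B(A) = {w | ∃v, R* w v ∧ v ∈ A} ∪ ({0} ∩ B), and define G : Set ℕ → Set ℕ by G(B) = {w | ∀v, R* w v → v ∈ ⋃_{n∈ℕ} H_B^[n](∅)}. Then for every n ∈ ℕ, 0 ∈ G^[n](ℕ). -/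
/-- The accessibility relation of the model `M*`: `0` sees every `m ≥ 1`,
and `i+1` sees `i`. -/
def Rstar : ℕ → ℕ → Prop := fun a b => (a = 0 ∧ 1 ≤ b) ∨ (∃ i : ℕ, a = i + 1 ∧ b = i)

/-- For `B ⊆ ℕ`, the semantic operator of the inner formula `μY(◇Y ∨ (p ∧ X))` of
`φ* = νX□μY(◇Y ∨ (p ∧ X))` on `M*`, where `p` holds exactly at `0` and `X` is
interpreted as `B`. -/
def Hstar (B : Set ℕ) : Set ℕ → Set ℕ :=
  fun A => {w : ℕ | ∃ v : ℕ, Rstar w v ∧ v ∈ A} ∪ ({0} ∩ B)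

/-- The semantic operator of the outer formula `□μY(◇Y ∨ (p ∧ X))` of `φ*` on `M*`,
with the inner μ interpreted via the ω-bounded (finitely bounded) semantics. -/
def Gstar : Set ℕ → Set ℕ :=
  fun B => {w : ℕ | ∀ v : ℕ, Rstar w v → v ∈ ⋃ n : ℕ, (Hstar B)^[n] ∅}

theorem mem_Hstar_iterate (B : Set ℕ) (hB : (0 : ℕ) ∈ B) :
    ∀ k : ℕ, k ∈ (Hstar B)^[k + 1] ∅ := by
  intro k
  induction k with
  | zero => exact Or.inr ⟨rfl, hB⟩
  | succ k ih =>
    rw [Function.iterate_succ_apply']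
    exact Or.inl ⟨k, Or.inr ⟨k, rfl, rfl⟩, ih⟩

/-- `0` belongs to every finite iterate of `Gstar` on `ℕ`: the sentence
`φ* = νX□μY(◇Y ∨ (p ∧ X))` holds at `w₀` of `M*` under the finitely bounded semantics. -/
theorem zero_mem_iterates_Gstar : ∀ n : ℕ, (0 : ℕ) ∈ Gstar^[n] Set.univ := by
  intro n
  induction n with
  | zero => exact Set.mem_univ _
  | succ n ih =>
    rw [Function.iterate_succ_apply']
    intro v _
    exact Set.mem_iUnion.2 ⟨v + 1, mem_Hstar_iterate _ ih v⟩
end
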